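/- Let t_1 < t_2 < … < t_n be real numbers and let λ ∈ ℝ^n be a nonzero vector with Σ_j λ_j (1, t_j, t_j², …, t_j^{d−1}) = 0 in ℝ^d. Then the sequence λ_1, …, λ_n has at least d sign changes (i.e., there exist indices j_0 < j_1 < … < j_d with λ_{j_r} λ_{j_{r+1}} < 0 for all r). -/

import Mathlib

open Finset

/-- If the moments of order `< d` of `lam` on the increasing nodes `t` vanish and the entries of
`lam` before a positive entry `i` are nonnegative (all after multiplication by `s`), then `lam` has
`d + 1` entries with alternating signs, the first of which has the sign of `s`. -/
theorem exists_strictMono_alternating_of_moments_eq_zero {n : ℕ} {t : Fin n → ℝ}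
    (ht : StrictMono t) (d : ℕ) (lam : Fin n → ℝ) (s : ℝ) (i : Fin n)
    (hi : 0 < s * lam i) (hlt : ∀ j < i, 0 ≤ s * lam j)
    (hmom : ∀ l < d, ∑ j, lam j * t j ^ l = 0) :
    ∃ js : Fin (d + 1) → Fin n, StrictMono js ∧
      ∀ r : Fin (d + 1), 0 < s * (-1) ^ (r : ℕ) * lam (js r) := by
  induction d generalizing lam s with
  | zero =>
    refine ⟨fun _ => i, Subsingleton.strictMono (α := Fin 1) _, fun r => ?_⟩
    simpa [Fin.fin_one_eq_zero r] using hi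
  | succ d ih =>
    have hneg : ∃ a, s * lam a < 0 := by
      by_contra! h
      have hsum : ∑ j, s * lam j = 0 := by
        have h0 := hmom 0 d.succ_pos
        simp only [pow_zero, mul_one] at h0
        rw [← Finset.mul_sum, h0, mul_zero]
      have := (Finset.sum_eq_zero_iff_of_nonneg fun j _ => h j).1 hsum i (Finset.mem_univ i)
      linarith
    obtain ⟨a, ha, hmin⟩ := wellFounded_lt.has_min {a | s * lam a < 0} hneg
    replace ha : s * lam a < 0 := ha
    replace hmin : ∀ j < a, 0 ≤ s * lam j := fun j hj => not_lt.1 fun h => hmin j h hj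
    have hia : i < a := by
      rcases lt_trichotomy i a with h | rfl | h
      · exact h
      · linarith
      · linarith [hlt a h]
    obtain ⟨c, hc, hca⟩ : ∃ c, (∀ j < a, t j < c) ∧ c < t a := by
      obtain ⟨b, hb, hmax⟩ := Finset.exists_max_image (Finset.univ.filter (· < a)) t
        ⟨i, by simpa using hia⟩
      obtain ⟨c, hbc, hca⟩ := exists_between (ht (Finset.mem_filter.1 hb).2)
      exact ⟨c, fun j hj => (hmax j (by simpa using hj)).trans_lt hbc, hca⟩
    obtain ⟨js, hjs, hsign⟩ := ih (fun j => lam j * (t j - c)) (-s)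
      (by nlinarith [mul_pos hi (sub_pos.2 (hc i hia))])
      (fun j hj => by
        nlinarith [mul_nonneg (hlt j hj) (sub_pos.2 (hc j (hj.trans hia))).le])
      (fun l hl => by
        have h1 := hmom (l + 1) (by lia)
        have h0 := hmom l (by lia)
        calc ∑ j, lam j * (t j - c) * t j ^ l
            = ∑ j, lam j * t j ^ (l + 1) - c * ∑ j, lam j * t j ^ l := by
              rw [Finset.mul_sum, ← Finset.sum_sub_distrib]
              exact Finset.sum_congr rfl fun j _ => by ring
          _ = 0 := by rw [h1, h0]; ring)
    have hmaxsign : ∀ r : Fin (d + 1), 0 < s * (-1) ^ ((r : ℕ) + 1) * lam (max a (js r)) := by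
      intro r
      have hr := hsign r
      rcases le_or_gt a (js r) with h | h
      · rw [max_eq_right h]
        have hpos : 0 < t (js r) - c := sub_pos.2 (hca.trans_le (ht.monotone h))
        refine (mul_pos_iff_of_pos_right hpos).1 ?_
        rw [pow_succ]
        linarith
      · rw [max_eq_left h.le]
        have hnn := mul_nonneg (hmin _ h) (sub_pos.2 (hc _ h)).le
        rcases neg_one_pow_eq_or ℝ (r : ℕ) with he | he
        · rw [pow_succ, he]
          linarith
        · rw [he] at hr
          linarith
    have hcons : ∀ r : Fin (d + 1 + 1), 0 < s * (-1) ^ (r : ℕ) *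
        lam (Fin.cons (α := fun _ => Fin n) i (fun r => max a (js r)) r) := by
      intro r
      cases r using Fin.cases with
      | zero => simpa using hi
      | succ r => simpa using hmaxsign r
    refine ⟨_, Fin.strictMono_iff_lt_succ.2 fun r => lt_of_le_of_ne ?_ fun h => ?_, hcons⟩
    · cases r using Fin.cases with
      | zero => simpa using Or.inl hia.le
      | succ r =>
        rw [← Fin.succ_castSucc, Fin.cons_succ, Fin.cons_succ]
        exact max_le_max le_rfl (hjs Fin.castSucc_lt_succ).le
    · have h0 := hcons r.castSucc
      have h1 := hcons r.succ
      rw [← h, Fin.val_succ, pow_succ] at h1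
      rw [Fin.val_castSucc] at h0
      linarith

/-- A nonzero linear dependence among points `(1, t_j, …, t_j^{d-1})` on the moment
curve, with `t_1 < … < t_n`, has at least `d` sign changes: there exist indices
`j_0 < j_1 < … < j_d` with consecutive coefficients of opposite (nonzero) signs. -/
theorem moment_curve_dependence_sign_changes (n d : ℕ) (t : Fin n → ℝ)
    (ht : StrictMono t) (lam : Fin n → ℝ) (hlam : lam ≠ 0)
    (hdep : ∑ j, lam j • (fun l : Fin d => t j ^ (l : ℕ)) = 0) :
    ∃ js : Fin (d + 1) → Fin n, StrictMono js ∧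
      ∀ r : Fin d, lam (js r.castSucc) * lam (js r.succ) < 0 := by
  obtain ⟨i, hi, hmin⟩ := wellFounded_lt.has_min {j | lam j ≠ 0} (Function.ne_iff.1 hlam)
  obtain ⟨js, hjs, hsign⟩ := exists_strictMono_alternating_of_moments_eq_zero ht d lam (lam i) i
    (mul_self_pos.2 hi)
    (fun j hj => by
      have : lam j = 0 := not_not.1 fun h => hmin j h hj
      simp [this])
    (fun l hl => by simpa using congrFun hdep ⟨l, hl⟩)
  refine ⟨js, hjs, fun r => ?_⟩
  have h0 := hsign r.castSucc
  have h1 := hsign r.succ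
  rw [Fin.val_succ, pow_succ] at h1
  rw [Fin.val_castSucc] at h0
  by_contra! h
  have hsq := mul_nonneg (sq_nonneg (lam i * (-1) ^ (r : ℕ))) h
  linarith [mul_pos h0 h1]
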